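/- Let T be an index set and (X_t)_{t∈T} a family of complex vector spaces. The tensor product ⨂_{t∈T} X_t is the internal direct sum of the subspaces S(x): (a) the supremum of the submodules S(x) over all x ∈ ∏_{t∈T} X_t is the whole space ⨂_{t∈T} X_t; and (b) the family of submodules S([x]) indexed by the equivalence classes [x] of ∼ (which is well defined, since x ∼ y implies S(x) = S(y)) is an independent family of submodules: if x_1,…,x_n are pairwise inequivalent and v_i ∈ S(x_i) satisfy ∑_i v_i = 0, then every v_i = 0. -/

import Mathlib

open scoped TensorProduct
open PiTensorProduct

namespace PiTensorProduct

theorem finite_ne_update_iff {T : Type*} {X : T → Type*} [DecidableEq T]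
    (x f : (t : T) → X t) (t : T) (a : X t) :
    {s : T | x s ≠ Function.update f t a s}.Finite ↔ {s : T | x s ≠ f s}.Finite := by
  constructor
  all_goals
    refine fun h => (h.insert t).subset fun s hs => ?_
    by_cases hst : s = t
    · exact Or.inl hst
    · exact Or.inr (by simpa [hst] using hs)

variable {R T : Type*} [CommSemiring R] {X : T → Type*}
  [∀ t, AddCommMonoid (X t)] [∀ t, Module R (X t)]

open Classical in
/-- The projection of `⨂[R] t, X t` onto the span of the elementary tensors of the families which
differ from `x` at finitely many indices: it kills all other elementary tensors. -/
noncomputable def projFiniteNe (x : (t : T) → X t) : (⨂[R] t, X t) →ₗ[R] ⨂[R] t, X t :=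
  lift
    { toFun := fun f => if {t : T | x t ≠ f t}.Finite then tprod R f else 0
      map_update_add' := fun f t a b => by
        simp only [finite_ne_update_iff]
        split_ifs <;> simp
      map_update_smul' := fun f t c a => by
        simp only [finite_ne_update_iff]
        split_ifs <;> simp }

theorem projFiniteNe_tprod_of_finite {x y : (t : T) → X t} (h : {t : T | x t ≠ y t}.Finite) :
    projFiniteNe x (tprod R y) = tprod R y := by
  rw [projFiniteNe, lift.tprod]
  exact if_pos h

theorem projFiniteNe_tprod_of_not_finite {x y : (t : T) → X t}
    (h : ¬ {t : T | x t ≠ y t}.Finite) :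
    projFiniteNe x (tprod R y) = 0 := by
  rw [projFiniteNe, lift.tprod]
  exact if_neg h

theorem projFiniteNe_of_mem_span {x : (t : T) → X t} {v : ⨂[R] t, X t}
    (hv : v ∈ Submodule.span R
      {w : ⨂[R] t, X t | ∃ y : (t : T) → X t,
        {t : T | x t ≠ y t}.Finite ∧ w = tprod R y}) :
    projFiniteNe x v = v := by
  refine LinearMap.eqOn_span (f := projFiniteNe x) (g := LinearMap.id) ?_ hv
  rintro _ ⟨y, hy, rfl⟩
  exact projFiniteNe_tprod_of_finite hy

theorem projFiniteNe_of_mem_span_of_not_finite {x z : (t : T) → X t}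
    (h : ¬ {t : T | x t ≠ z t}.Finite) {v : ⨂[R] t, X t}
    (hv : v ∈ Submodule.span R
      {w : ⨂[R] t, X t | ∃ y : (t : T) → X t,
        {t : T | z t ≠ y t}.Finite ∧ w = tprod R y}) :
    projFiniteNe x v = 0 := by
  refine LinearMap.eqOn_span (f := projFiniteNe x) (g := 0) ?_ hv
  rintro _ ⟨y, hy, rfl⟩
  refine projFiniteNe_tprod_of_not_finite fun hxy => h ((hxy.union hy).subset fun t ht => ?_)
  by_cases hxt : x t = y t
  · exact Or.inr fun hzt => ht (hxt.trans hzt.symm)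
  · exact Or.inl hxt

end PiTensorProduct

/-- `⨂_{t∈T} X_t` is the internal direct sum of the subspaces `S(x)`:
(a) the supremum of the `S(x)` over all `x ∈ ∏_t X_t` is the whole space, and
(b) for pairwise inequivalent `x_1, …, x_n` and `v_i ∈ S(x_i)` with `∑ v_i = 0`, all
`v_i` vanish. -/
theorem stmt_6 {T : Type*} (X : T → Type*)
    [∀ t, AddCommGroup (X t)] [∀ t, Module ℂ (X t)] :
    (⨆ x : (t : T) → X t,
        Submodule.span ℂ
          {v : ⨂[ℂ] t : T, X t | ∃ y : (t : T) → X t,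
            ({t : T | x t ≠ y t}).Finite ∧ v = tprod ℂ y}) = ⊤ ∧
    (∀ (n : ℕ) (x : Fin n → (t : T) → X t),
      (Pairwise fun i j => ¬ ({t : T | x i t ≠ x j t}).Finite) →
      ∀ v : Fin n → ⨂[ℂ] t : T, X t,
        (∀ i, v i ∈ Submodule.span ℂ
          {w : ⨂[ℂ] t : T, X t | ∃ y : (t : T) → X t,
            ({t : T | x i t ≠ y t}).Finite ∧ w = tprod ℂ y}) →
        (∑ i, v i) = 0 → ∀ i, v i = 0) := by
  refine ⟨?_, fun n x hx v hv hsum i => ?_⟩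
  · rw [eq_top_iff, ← span_tprod_eq_top, Submodule.span_le]
    rintro _ ⟨f, rfl⟩
    exact Submodule.mem_iSup_of_mem f (Submodule.subset_span ⟨f, by simp, rfl⟩)
  · have h := congrArg (projFiniteNe (x i)) hsum
    rw [map_sum, map_zero, Finset.sum_eq_single i, projFiniteNe_of_mem_span (hv i)] at h
    · exact h
    · exact fun j _ hj => projFiniteNe_of_mem_span_of_not_finite (hx hj.symm) (hv j)
    · simp
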